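/- arXiv:1604.01925 — 2 statements merged into one kernel-verified Lean document; each statement's English description precedes it below -/
import Mathlib

section
/- Let q be a prime power, m ≥ 1 an integer, and σ, δ ∈ (0,1) reals with δ < (1−σ)/2. Let t be an even integer with t ≥ 4, and let k, n, d be positive integers with d > 1, k + n ≤ q, and d < σn/(k+t). Then the Reed-Muller code RM(q,d,m) is a (k; n, δ, ε)-locally correctable code, where ε = 8·((4tδn + 4t²)/((1−σ−2δ)² n²))^{t/2}. -/
open scoped BigOperators

/-- `C ⊆ F^I` is a `(k; r, δ, ε)`-locally correctable code: for every `S ⊆ I` with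
`|S| ≤ k` there is a (finitely supported) probability distribution over pairs `(T, g)`,
`T ⊆ I` with `|T| ≤ r` and `g : (T → F) → (S → F)`, such that for every codeword `c ∈ C`
and every `y` within relative Hamming distance `δ` of `c`, the probability that
`g (y|_T) = c|_S` is at least `1 - ε`. -/
def LocallyCorrectable {F I : Type*} [Fintype F] [DecidableEq F] [Fintype I]
    (C : Set (I → F)) (k r : ℕ) (δ ε : ℝ) : Prop :=
  ∀ S : Finset I, S.card ≤ k →
    ∃ D : PMF ((T : Finset I) × ((↥T → F) → (↥S → F))),
      (∀ p ∈ D.support, p.1.card ≤ r) ∧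
      ∀ c ∈ C, ∀ y : I → F,
        (hammingDist y c : ℝ) ≤ δ * (Fintype.card I) →
          ENNReal.ofReal (1 - ε) ≤
            D.toOuterMeasure {p | p.2 (fun t => y t.1) = fun s => c s.1}

/-- The Reed-Muller code `RM(q,d,m)`: evaluation vectors over `F^m` of `m`-variate
polynomials of total degree at most `d`. -/
def ReedMullerCode (F : Type*) [CommSemiring F] (d m : ℕ) : Set ((Fin m → F) → F) :=
  {w | ∃ f : MvPolynomial (Fin m) F, f.totalDegree ≤ d ∧ ∀ u, MvPolynomial.eval u f = w u}

theorem sum_prod_apply_eq_prod_sum {α ι : Type*} [Fintype α] [Fintype ι] [DecidableEq ι]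
    (h : ι → α → ℝ) : ∑ v : ι → α, ∏ j, h j (v j) = ∏ j, ∑ a, h j a := by
  rw [Finset.prod_univ_sum, Fintype.piFinset_univ]

theorem factorial_mul_exp_le {t : ℕ} (ht : 2 ≤ t) :
    (t.factorial : ℝ) * Real.exp (3 / 4 * t) ≤ 4 * (t : ℝ) ^ t := by
  induction t, ht using Nat.le_induction with
  | base =>
    have h1 : Real.exp (3 / 4 * (2 : ℕ)) = Real.exp (3 / 4) ^ 2 := by
      rw [← Real.exp_nat_mul]; norm_num
    have h2 := (abs_le.1 (Real.exp_bound (x := 3 / 4) (by norm_num) (n := 2) (by norm_num))).2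
    norm_num [Finset.sum_range_succ] at h2
    have h3 := Real.exp_pos (3 / 4)
    rw [h1]
    norm_num
    nlinarith
  | succ t ht ih =>
    have ht0 : (2 : ℝ) ≤ t := by exact_mod_cast ht
    have h1 : Real.exp (3 / 4) * (t : ℝ) ^ t ≤ (t + 1) ^ t := by
      have h2 : Real.exp (3 / 4) ≤ (1 + 1 / (t : ℝ)) ^ t := by
        rw [← Real.log_le_log_iff (Real.exp_pos _) (by positivity), Real.log_exp, Real.log_pow]
        have h3 := Real.le_log_one_add_of_nonneg (x := 1 / (t : ℝ)) (by positivity)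
        have h4 : (3 : ℝ) / 4 ≤ t * (2 * (1 / (t : ℝ)) / (1 / t + 2)) := by
          have h5 : t * (2 * (1 / (t : ℝ)) / (1 / t + 2)) = 2 * t / (1 + 2 * t) := by
            field_simp
          rw [h5, div_le_div_iff₀ (by norm_num) (by positivity)]
          linarith
        exact h4.trans (by gcongr)
      calc Real.exp (3 / 4) * (t : ℝ) ^ t ≤ (1 + 1 / (t : ℝ)) ^ t * (t : ℝ) ^ t := by gcongr
        _ = (t + 1) ^ t := by
          rw [← mul_pow]; congr 1; field_simp
    have h6 : Real.exp (3 / 4 * ((t + 1 : ℕ) : ℝ)) = Real.exp (3 / 4 * t) * Real.exp (3 / 4) := by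
      rw [← Real.exp_add]; push_cast; ring_nf
    rw [Nat.factorial_succ, h6, pow_succ]
    push_cast
    calc ((t : ℝ) + 1) * t.factorial * (Real.exp (3 / 4 * t) * Real.exp (3 / 4))
        = (t + 1) * Real.exp (3 / 4) * (t.factorial * Real.exp (3 / 4 * t)) := by ring
      _ ≤ (t + 1) * Real.exp (3 / 4) * (4 * (t : ℝ) ^ t) := by gcongr
      _ = 4 * (t + 1) * (Real.exp (3 / 4) * (t : ℝ) ^ t) := by ring
      _ ≤ 4 * (t + 1) * (t + 1) ^ t := by gcongr
      _ = _ := by ring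

/-- The density of `B`. -/
noncomputable def density {α : Type*} [Fintype α] (B : Finset α) : ℝ := B.card / Fintype.card α

/-- The indicator function of `B`, shifted to have mean zero. -/
noncomputable def centeredIndicator {α : Type*} [Fintype α] [DecidableEq α] (B : Finset α)
    (a : α) : ℝ :=
  (if a ∈ B then 1 else 0) - density B

theorem density_nonneg {α : Type*} [Fintype α] (B : Finset α) : 0 ≤ density B := by
  unfold density; positivity

theorem sum_exp_centeredIndicator_le {α : Type*} [Fintype α] [Nonempty α] [DecidableEq α]
    (B : Finset α) {x : ℝ} (hx : |x| ≤ 1) :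
    ∑ a, Real.exp (x * centeredIndicator B a) ≤
      Fintype.card α * Real.exp (3 / 4 * x ^ 2 * density B) := by
  have hα : (0 : ℝ) < Fintype.card α := by exact_mod_cast Fintype.card_pos
  have hB : (B.card : ℝ) = Fintype.card α * density B := by unfold density; field_simp
  have h1 : ∀ a, Real.exp (x * centeredIndicator B a) =
      Real.exp (-(x * density B)) * (1 + if a ∈ B then Real.exp x - 1 else 0) := by
    intro a
    unfold centeredIndicator
    split_ifs
    · rw [add_sub_cancel, ← Real.exp_add]; ring_nf
    · simp
  have h2 : Real.exp x - 1 ≤ x + 3 / 4 * x ^ 2 := by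
    have h := (abs_le.1 (Real.exp_bound hx (n := 2) (by norm_num))).2
    norm_num [Finset.sum_range_succ] at h
    linarith
  calc ∑ a, Real.exp (x * centeredIndicator B a)
      = Fintype.card α * (Real.exp (-(x * density B)) * (1 + density B * (Real.exp x - 1))) := by
        simp_rw [h1]
        rw [← Finset.mul_sum, Finset.sum_add_distrib]
        simp only [Finset.sum_const, Finset.card_univ, nsmul_eq_mul, mul_one, Finset.sum_ite_mem,
          Finset.univ_inter, hB]
        ring
    _ ≤ Fintype.card α *
        (Real.exp (-(x * density B)) * Real.exp (density B * (x + 3 / 4 * x ^ 2))) := by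
        gcongr
        rw [add_comm]
        refine le_trans ?_ (Real.add_one_le_exp _)
        gcongr
        exact density_nonneg B
    _ = _ := by rw [← Real.exp_add]; ring_nf

theorem pow_le_factorial_mul_exp_add_exp {t : ℕ} (ht : Even t) (x : ℝ) :
    x ^ t ≤ t.factorial * (Real.exp x + Real.exp (-x)) := by
  have h := Real.pow_div_factorial_le_exp |x| (abs_nonneg x) t
  rw [ht.pow_abs, div_le_iff₀ (by positivity)] at h
  have h2 : Real.exp |x| ≤ Real.exp x + Real.exp (-x) := by
    rcases abs_cases x with ⟨h, -⟩ | ⟨h, -⟩ <;> rw [h] <;>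
      linarith [Real.exp_pos x, Real.exp_pos (-x)]
  calc x ^ t ≤ Real.exp |x| * t.factorial := h
    _ ≤ (Real.exp x + Real.exp (-x)) * t.factorial := by gcongr
    _ = _ := mul_comm _ _

theorem sum_exp_sum_centeredIndicator_le {α ι : Type*} [Fintype α] [Nonempty α] [DecidableEq α]
    [Fintype ι] [DecidableEq ι] (B : Finset α) {x : ℝ} (hx : |x| ≤ 1) :
    ∑ v : ι → α, Real.exp (x * ∑ j, centeredIndicator B (v j)) ≤
      (Fintype.card α : ℝ) ^ Fintype.card ι *
        Real.exp (3 / 4 * x ^ 2 * (Fintype.card ι * density B)) := by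
  calc ∑ v : ι → α, Real.exp (x * ∑ j, centeredIndicator B (v j))
      = (∑ a, Real.exp (x * centeredIndicator B a)) ^ Fintype.card ι := by
        simp_rw [Finset.mul_sum, Real.exp_sum]
        rw [sum_prod_apply_eq_prod_sum fun (_ : ι) a => Real.exp (x * centeredIndicator B a)]
        simp
    _ ≤ (Fintype.card α * Real.exp (3 / 4 * x ^ 2 * density B)) ^ Fintype.card ι := by
        gcongr
        exact sum_exp_centeredIndicator_le B hx
    _ = _ := by
        rw [mul_pow, ← Real.exp_nat_mul]; ring_nf

/-- Central moments of even order of a binomially distributed random variable. -/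
theorem sum_pow_sum_centeredIndicator_le {α ι : Type*} [Fintype α] [Nonempty α] [DecidableEq α]
    [Fintype ι] [DecidableEq ι] (B : Finset α) {t : ℕ} (ht : Even t) (ht2 : 2 ≤ t) :
    ∑ v : ι → α, (∑ j, centeredIndicator B (v j)) ^ t ≤
      (Fintype.card α : ℝ) ^ Fintype.card ι *
        (8 * (t * (Fintype.card ι * density B) + (t : ℝ) ^ 2) ^ (t / 2)) := by
  obtain ⟨r, hr⟩ := ht.two_dvd
  have htr : t / 2 = r := by omega
  rw [htr]
  set μ : ℝ := Fintype.card ι * density B with hμ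
  have hμ0 : 0 ≤ μ := by have := density_nonneg B; positivity
  set N : ℝ := (Fintype.card α : ℝ) ^ Fintype.card ι with hN
  have ht0 : (0 : ℝ) < t := by positivity
  have hq0 : 0 < (t : ℝ) / (μ + t) := by positivity
  set x : ℝ := √(t / (μ + t)) with hxdef
  have hx2 : x ^ 2 = t / (μ + t) := Real.sq_sqrt hq0.le
  have hx1 : |x| ≤ 1 := by
    refine (abs_of_nonneg (Real.sqrt_nonneg _)).trans_le (Real.sqrt_le_one.2 ?_)
    rw [div_le_one (by positivity)]
    linarith
  have hxμ : 3 / 4 * x ^ 2 * μ ≤ 3 / 4 * t := by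
    rw [hx2, mul_assoc]
    gcongr
    rw [div_mul_eq_mul_div, div_le_iff₀ (by positivity)]
    nlinarith
  have hxt : x ^ t = (t / (μ + t)) ^ r := by rw [hr, pow_mul, hx2, hr]
  have key : x ^ t * ∑ v : ι → α, (∑ j, centeredIndicator B (v j)) ^ t ≤
      N * (8 * (t : ℝ) ^ t) := by
    calc x ^ t * ∑ v : ι → α, (∑ j, centeredIndicator B (v j)) ^ t
        = ∑ v : ι → α, (x * ∑ j, centeredIndicator B (v j)) ^ t := by
          simp_rw [mul_pow, Finset.mul_sum]
      _ ≤ ∑ v : ι → α, (t.factorial * (Real.exp (x * ∑ j, centeredIndicator B (v j)) +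
            Real.exp ((-x) * ∑ j, centeredIndicator B (v j)))) := by
          gcongr with v
          rw [neg_mul]
          exact pow_le_factorial_mul_exp_add_exp ht _
      _ = t.factorial * (∑ v : ι → α, Real.exp (x * ∑ j, centeredIndicator B (v j)) +
            ∑ v : ι → α, Real.exp ((-x) * ∑ j, centeredIndicator B (v j))) := by
          rw [← Finset.mul_sum, Finset.sum_add_distrib]
      _ ≤ t.factorial * (N * Real.exp (3 / 4 * t) + N * Real.exp (3 / 4 * t)) := by
          gcongr
          · refine (sum_exp_sum_centeredIndicator_le B hx1).trans ?_
            gcongr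
          · refine (sum_exp_sum_centeredIndicator_le B (x := -x) (by rwa [abs_neg])).trans ?_
            rw [neg_sq]
            gcongr
      _ = 2 * N * (t.factorial * Real.exp (3 / 4 * t)) := by ring
      _ ≤ 2 * N * (4 * (t : ℝ) ^ t) := by
          gcongr ?_ * ?_
          exact factorial_mul_exp_le ht2
      _ = _ := by ring
  have hxpos : 0 < x ^ t := by rw [hxt]; positivity
  refine le_of_mul_le_mul_left (key.trans_eq ?_) hxpos
  have h3 : (t : ℝ) * μ + (t : ℝ) ^ 2 = t * (μ + t) := by ring
  have h4 : (t : ℝ) ^ t = ((t : ℝ) ^ 2) ^ r := by rw [← pow_mul, ← hr]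
  have h5 : (t / (μ + t)) ^ r * (t * (μ + t)) ^ r = ((t : ℝ) ^ 2) ^ r := by
    rw [← mul_pow]; congr 1; field_simp
  rw [hxt, h3, h4, ← h5]
  ring

/-- Any `t` of the random variables `V · j`, for a uniformly distributed argument, are independent
and uniformly distributed. -/
def IsWiseUniform {Ω α ι : Type*} [Fintype Ω] [Fintype α] (t : ℕ) (V : Ω → ι → α) : Prop :=
  ∀ J : Finset ι, J.card ≤ t → ∀ h : ι → α → ℝ,
    (Fintype.card α : ℝ) ^ J.card * ∑ ω, ∏ j ∈ J, h j (V ω j) =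
      Fintype.card Ω * ∏ j ∈ J, ∑ a, h j a

theorem isWiseUniform_id {α ι : Type*} [Fintype α] [Fintype ι] [DecidableEq ι]
    (t : ℕ) : IsWiseUniform t (id : (ι → α) → ι → α) := by
  intro J _ h
  have h1 : ∀ v : ι → α, ∏ j ∈ J, h j (v j) = ∏ j, if j ∈ J then h j (v j) else 1 := by
    intro v; rw [Finset.prod_ite_mem, Finset.univ_inter]
  simp only [id, h1]
  rw [sum_prod_apply_eq_prod_sum fun j a => if j ∈ J then h j a else 1]
  have h2 : ∀ j, ∑ a, (if j ∈ J then h j a else 1) =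
      (if j ∈ J then ∑ a, h j a else 1) * (if j ∈ J then 1 else (Fintype.card α : ℝ)) := by
    intro j; split_ifs <;> simp
  simp_rw [h2]
  rw [Finset.prod_mul_distrib, Finset.prod_ite_mem, Finset.univ_inter, Finset.prod_ite,
    Finset.prod_const_one, one_mul, Finset.prod_const]
  have h3 : (Finset.univ.filter (fun j => j ∉ J)).card = Fintype.card ι - J.card := by
    rw [← Finset.card_compl]; congr 1; ext; simp
  rw [h3, Fintype.card_fun, Nat.cast_pow,
    ← Nat.add_sub_of_le (Finset.card_le_univ J), pow_add, Nat.add_sub_cancel_left]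
  ring

theorem IsWiseUniform.sum_pow_eq {Ω α ι : Type*} [Fintype Ω] [Fintype α] [Nonempty α]
    [Fintype ι] [DecidableEq ι] {t : ℕ} {V : Ω → ι → α} (hV : IsWiseUniform t V) (z : α → ℝ) :
    (Fintype.card α : ℝ) ^ Fintype.card ι * ∑ ω, (∑ j, z (V ω j)) ^ t =
      Fintype.card Ω * ∑ v : ι → α, (∑ j, z (v j)) ^ t := by
  have hα : (Fintype.card α : ℝ) ≠ 0 := by exact_mod_cast Fintype.card_ne_zero
  simp_rw [Fintype.sum_pow]
  rw [Finset.sum_comm, Finset.sum_comm (s := (Finset.univ : Finset (ι → α))), Finset.mul_sum,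
    Finset.mul_sum]
  refine Finset.sum_congr rfl fun p _ => ?_
  have hJ : (Finset.univ.image p).card ≤ t := Finset.card_image_le.trans (by simp)
  have h1 : ∀ v : ι → α, ∏ i, z (v (p i)) =
      ∏ j ∈ Finset.univ.image p, z (v j) ^ (Finset.univ.filter (fun i => p i = j)).card :=
    fun v => Finset.prod_comp (fun j => z (v j)) p
  simp_rw [h1]
  have h2 := hV _ hJ fun j a => z a ^ (Finset.univ.filter (fun i => p i = j)).card
  have h3 := isWiseUniform_id (α := α) t _ hJ
    fun j a => z a ^ (Finset.univ.filter (fun i => p i = j)).card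
  simp only [id] at h3
  rw [Fintype.card_fun, Nat.cast_pow] at h3
  refine mul_left_cancel₀ (pow_ne_zero (Finset.univ.image p).card hα) ?_
  linear_combination (Fintype.card α : ℝ) ^ Fintype.card ι * h2 - (Fintype.card Ω : ℝ) * h3

/-- The tail bound of Bellare and Rompel for `t`-wise independent random variables. -/
theorem IsWiseUniform.card_le_mul_pow_le {Ω α ι : Type*} [Fintype Ω] [Fintype α] [Nonempty α]
    [DecidableEq α] [Fintype ι] [DecidableEq ι] {t : ℕ} {V : Ω → ι → α}
    (hV : IsWiseUniform t V) (ht : Even t) (ht2 : 2 ≤ t) (B : Finset α) {A : ℝ} (hA : 0 ≤ A)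
    (E : Finset Ω) (hE : ∀ ω ∈ E, A ≤ ∑ j, centeredIndicator B (V ω j)) :
    E.card * A ^ t ≤
      Fintype.card Ω * (8 * (t * (Fintype.card ι * density B) + (t : ℝ) ^ 2) ^ (t / 2)) := by
  have hα : (0 : ℝ) < Fintype.card α := by exact_mod_cast Fintype.card_pos
  have h1 : E.card * A ^ t ≤ ∑ ω, (∑ j, centeredIndicator B (V ω j)) ^ t := by
    calc E.card * A ^ t = ∑ ω ∈ E, A ^ t := by simp
      _ ≤ ∑ ω ∈ E, (∑ j, centeredIndicator B (V ω j)) ^ t := by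
        gcongr with ω hω
        exact hE ω hω
      _ ≤ _ := Finset.sum_le_sum_of_subset_of_nonneg (Finset.subset_univ _)
        fun _ _ _ => ht.pow_nonneg _
  refine h1.trans ?_
  refine le_of_mul_le_mul_left ?_ (pow_pos hα (Fintype.card ι))
  rw [hV.sum_pow_eq, mul_left_comm]
  gcongr
  exact sum_pow_sum_centeredIndicator_le B ht ht2

theorem sum_comp_addMonoidHom {G H : Type*} [AddGroup G] [Fintype G] [AddGroup H] [Fintype H]
    [DecidableEq H] (φ : G →+ H) (hφ : Function.Surjective φ) (f : H → ℝ) :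
    Fintype.card H * ∑ g, f (φ g) = Fintype.card G * ∑ h, f h := by
  have hfib : ∀ h, (Finset.univ.filter fun g => φ g = h).card =
      (Finset.univ.filter fun g => φ g = 0).card :=
    fun h => AddMonoidHom.card_fiber_eq_of_mem_range φ (hφ h) (hφ 0)
  have hsum : ∀ f : H → ℝ, ∑ g, f (φ g) =
      (Finset.univ.filter fun g => φ g = 0).card * ∑ h, f h := by
    intro f
    rw [Finset.sum_comp f φ, Finset.image_univ_of_surjective hφ, Finset.mul_sum]
    simp_rw [hfib, nsmul_eq_mul]
  have hcard := hsum fun _ => 1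
  simp only [Finset.sum_const, Finset.card_univ, nsmul_eq_mul, mul_one] at hcard
  rw [hsum, hcard]
  ring

/-- The polynomial with given coefficients. -/
noncomputable def polyOfCoeffs {F : Type*} [Field F] {t : ℕ} (c : Fin t → F) : Polynomial F :=
  ∑ l : Fin t, Polynomial.C (c l) * Polynomial.X ^ (l : ℕ)

theorem natDegree_polyOfCoeffs_le {F : Type*} [Field F] {t : ℕ} (c : Fin t → F) :
    (polyOfCoeffs c).natDegree ≤ t :=
  Polynomial.natDegree_sum_le_of_forall_le _ _ fun l _ =>
    (Polynomial.natDegree_C_mul_X_pow_le _ _).trans l.2.le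

theorem eval_polyOfCoeffs {F : Type*} [Field F] {t : ℕ} (c : Fin t → F) (x : F) :
    (polyOfCoeffs c).eval x = ∑ l, c l * x ^ (l : ℕ) := by
  simp [polyOfCoeffs, Polynomial.eval_finsetSum]

theorem exists_polyOfCoeffs_eval_eq {F ι : Type*} [Field F] {t : ℕ} (ht : 0 < t)
    (J : Finset ι) (hJ : J.card ≤ t) {b : ι → F} (hb : Function.Injective b) (w : J → F) :
    ∃ c : Fin t → F, ∀ j : J, (polyOfCoeffs c).eval (b j) = w j := by
  classical
  have hinj : Set.InjOn (fun j : J => b j) (Finset.univ : Finset J) :=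
    fun x _ y _ h => Subtype.ext (hb h)
  set p := Lagrange.interpolate (Finset.univ : Finset J) (fun j => b j) w with hp
  have hdeg : p.natDegree < t := by
    rcases eq_or_ne p 0 with h0 | h0
    · simpa [h0]
    · rw [Polynomial.natDegree_lt_iff_degree_lt h0]
      refine (Lagrange.degree_interpolate_lt w hinj).trans_le ?_
      simpa using hJ
  refine ⟨fun l => p.coeff l, fun j => ?_⟩
  rw [eval_polyOfCoeffs, Fin.sum_univ_eq_sum_range (fun l => p.coeff l * b j ^ l),
    ← Polynomial.eval_eq_sum_range' hdeg]
  exact Lagrange.eval_interpolate_at_node w hinj (Finset.mem_univ j)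

theorem isWiseUniform_eval {F ι : Type*} [Field F] [Fintype F] [DecidableEq F] [DecidableEq ι]
    {m t : ℕ} (ht : 0 < t) {b : ι → F} (hb : Function.Injective b) (base : ι → Fin m → F)
    {s : ι → F} (hs : ∀ j, s j ≠ 0) :
    IsWiseUniform t fun (ω : Fin m → Fin t → F) j i =>
      base j i + s j * (polyOfCoeffs (ω i)).eval (b j) := by
  intro J hJ h
  let φ : (Fin m → Fin t → F) →+ (J → Fin m → F) :=
    { toFun := fun ω j i => (polyOfCoeffs (ω i)).eval (b j)
      map_zero' := by ext; simp [eval_polyOfCoeffs]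
      map_add' := by intros; ext; simp [eval_polyOfCoeffs, add_mul, Finset.sum_add_distrib] }
  have hφ : Function.Surjective φ := by
    intro w
    choose c hc using fun i => exists_polyOfCoeffs_eval_eq ht J hJ hb fun j => w j i
    exact ⟨c, funext fun j => funext fun i => hc i j⟩
  have h1 := sum_comp_addMonoidHom φ hφ fun w =>
    ∏ j : J, h j (fun i => base j i + s j * w j i)
  rw [sum_prod_apply_eq_prod_sum fun (j : J) (a : Fin m → F) =>
    h j (fun i => base j i + s j * a i)] at h1
  have h2 : ∀ j, ∑ a : Fin m → F, h j (fun i => base j i + s j * a i) = ∑ a, h j a := by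
    intro j
    refine Function.Bijective.sum_comp (g := h j)
      (e := fun (a : Fin m → F) i => base j i + s j * a i) ?_
    refine (Finite.injective_iff_bijective).1 fun a a' haa => funext fun i => ?_
    exact mul_left_cancel₀ (hs j) (add_left_cancel (congrFun haa i))
  simp_rw [h2] at h1
  rw [Finset.prod_coe_sort J fun j => ∑ a, h j a] at h1
  have h3 : ∀ ω, ∏ j : J, h j (fun i => base j i + s j * φ ω j i) =
      ∏ j ∈ J, h j (fun i => base j i + s j * (polyOfCoeffs (ω i)).eval (b j)) :=
    fun ω => Finset.prod_coe_sort J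
      fun j => h j (fun i => base j i + s j * (polyOfCoeffs (ω i)).eval (b j))
  simp_rw [h3] at h1
  rw [← h1, Fintype.card_fun (α := J), Fintype.card_coe, Nat.cast_pow]

open Classical in
/-- A polynomial of degree at most `D` whose values at the points `b` are at distance less than `ρ`
from `w`, or zero if there is none. -/
noncomputable def nearbyPoly {F ι : Type*} [Field F] [DecidableEq F] [Fintype ι]
    (b : ι → F) (D : ℕ) (ρ : ℝ) (w : ι → F) : Polynomial F :=
  if h : ∃ p : Polynomial F, p.natDegree ≤ D ∧ (hammingDist w fun j => p.eval (b j) : ℝ) < ρ then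
    h.choose
  else 0

theorem eq_of_hammingDist_eval_lt {F ι : Type*} [Field F] [DecidableEq F] [Fintype ι]
    {b : ι → F} (hb : Function.Injective b) {D : ℕ} {p p' : Polynomial F}
    (hp : p.natDegree ≤ D) (hp' : p'.natDegree ≤ D)
    (h : D + hammingDist (fun j => p.eval (b j)) (fun j => p'.eval (b j)) < Fintype.card ι) :
    p = p' := by
  classical
  rw [← sub_eq_zero]
  refine Polynomial.eq_zero_of_natDegree_lt_card_of_eval_eq_zero' _
    ((Finset.univ.filter fun j => p.eval (b j) = p'.eval (b j)).image b) ?_ ?_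
  · intro x hx
    obtain ⟨j, hj, rfl⟩ := Finset.mem_image.1 hx
    rw [Polynomial.eval_sub, sub_eq_zero]
    exact (Finset.mem_filter.1 hj).2
  · rw [Finset.card_image_of_injective _ hb]
    have h1 := Finset.card_filter_add_card_filter_not (s := (Finset.univ : Finset ι))
      fun j => p.eval (b j) = p'.eval (b j)
    rw [Finset.card_univ] at h1
    have h2 : hammingDist (fun j => p.eval (b j)) (fun j => p'.eval (b j)) =
      (Finset.univ.filter fun j => ¬ p.eval (b j) = p'.eval (b j)).card := rfl
    have h3 := Polynomial.natDegree_sub_le_of_le hp hp'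
    rw [max_self] at h3
    omega

theorem nearbyPoly_eq {F ι : Type*} [Field F] [DecidableEq F] [Fintype ι]
    {b : ι → F} (hb : Function.Injective b) {D : ℕ} {ρ : ℝ} (hρ : D + 2 * ρ ≤ Fintype.card ι)
    {w : ι → F} {p : Polynomial F} (hp : p.natDegree ≤ D)
    (hw : (hammingDist w fun j => p.eval (b j) : ℝ) < ρ) : nearbyPoly b D ρ w = p := by
  have h : ∃ p : Polynomial F, p.natDegree ≤ D ∧
    (hammingDist w fun j => p.eval (b j) : ℝ) < ρ := ⟨p, hp, hw⟩
  rw [nearbyPoly, dif_pos h]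
  refine eq_of_hammingDist_eval_lt hb h.choose_spec.1 hp ?_
  have h1 := h.choose_spec.2
  have h2 : (hammingDist (fun j => h.choose.eval (b j)) (fun j => p.eval (b j)) : ℝ) ≤
      hammingDist w (fun j => h.choose.eval (b j)) + hammingDist w fun j => p.eval (b j) := by
    exact_mod_cast hammingDist_triangle_left _ _ w
  have h3 : (D + hammingDist (fun j => h.choose.eval (b j)) (fun j => p.eval (b j)) : ℝ) <
      Fintype.card ι := by linarith
  exact_mod_cast h3

theorem sum_centeredIndicator_eq {α ι : Type*} [Fintype α] [DecidableEq α] [Fintype ι]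
    (B : Finset α) (v : ι → α) :
    ∑ j, centeredIndicator B (v j) =
      (Finset.univ.filter fun j => v j ∈ B).card - Fintype.card ι * density B := by
  simp [centeredIndicator, Finset.sum_sub_distrib]

/-- For most `ω`, sampling two nearby words at the points `V ω` yields nearby words. -/
theorem IsWiseUniform.card_hammingDist_le {Ω α ι F : Type*} [Fintype Ω] [Fintype α] [Nonempty α]
    [DecidableEq α] [DecidableEq F] [Fintype ι] [DecidableEq ι] {t : ℕ} {V : Ω → ι → α}
    (hV : IsWiseUniform t V) (ht : Even t) (ht2 : 2 ≤ t) {y c : α → F} {δ A : ℝ}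
    (hyc : (hammingDist y c : ℝ) ≤ δ * Fintype.card α) (hA : 0 < A) (E : Finset Ω)
    (hE : ∀ ω ∈ E, Fintype.card ι * δ + A ≤
      hammingDist (fun j => y (V ω j)) (fun j => c (V ω j))) :
    (E.card : ℝ) ≤
      8 * ((t * δ * Fintype.card ι + (t : ℝ) ^ 2) / A ^ 2) ^ (t / 2) * Fintype.card Ω := by
  have hα : (0 : ℝ) < Fintype.card α := by exact_mod_cast Fintype.card_pos
  set B : Finset α := Finset.univ.filter fun a => y a ≠ c a with hB
  have hBδ : density B ≤ δ := (div_le_iff₀ hα).2 hyc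
  have h1 := hV.card_le_mul_pow_le ht ht2 B hA.le E fun ω hω => by
    have h2 : (Finset.univ.filter fun j => V ω j ∈ B).card =
        hammingDist (fun j => y (V ω j)) (fun j => c (V ω j)) := by
      simp [hB, hammingDist]
    rw [sum_centeredIndicator_eq, h2]
    have h3 : (Fintype.card ι : ℝ) * density B ≤ Fintype.card ι * δ := by gcongr
    linarith [hE ω hω]
  have hAt : A ^ t = (A ^ 2) ^ (t / 2) := by rw [← pow_mul, Nat.mul_div_cancel' ht.two_dvd]
  rw [div_pow, ← hAt, mul_div_assoc', div_mul_eq_mul_div, le_div_iff₀ (by positivity)]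
  refine h1.trans ?_
  rw [mul_comm]
  have h0 := density_nonneg B
  have h4 : (t : ℝ) * (Fintype.card ι * density B) + (t : ℝ) ^ 2 ≤
      t * δ * Fintype.card ι + (t : ℝ) ^ 2 := by
    rw [mul_assoc, mul_comm δ]
    gcongr
  gcongr

theorem ofReal_le_toOuterMeasure_map_uniformOfFintype {Ω β : Type*} [Fintype Ω] [Nonempty Ω]
    [DecidableEq Ω] (f : Ω → β) (s : Set β) (E : Finset Ω) (hs : ∀ ω ∉ E, f ω ∈ s) {ε : ℝ}
    (hE : (E.card : ℝ) ≤ ε * Fintype.card Ω) :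
    ENNReal.ofReal (1 - ε) ≤ ((PMF.uniformOfFintype Ω).map f).toOuterMeasure s := by
  have hΩ : (0 : ℝ) < Fintype.card Ω := by exact_mod_cast Fintype.card_pos
  rw [PMF.toOuterMeasure_map_apply]
  have hsub : ((Eᶜ : Finset Ω) : Set Ω) ⊆ f ⁻¹' s := by
    intro ω hω
    exact hs ω (by simpa using hω)
  refine le_trans ?_ (MeasureTheory.measure_mono hsub)
  rw [PMF.toOuterMeasure_uniformOfFintype_apply]
  refine ENNReal.ofReal_le_of_le_toReal ?_
  have h1 : Fintype.card ↑((Eᶜ : Finset Ω) : Set Ω) = Eᶜ.card := by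
    rw [← Fintype.card_coe Eᶜ]; exact Fintype.card_congr (Equiv.refl _)
  rw [h1, ENNReal.toReal_div, ENNReal.toReal_natCast, ENNReal.toReal_natCast,
    le_div_iff₀ hΩ, Finset.card_compl, Nat.cast_sub (Finset.card_le_univ E)]
  linarith

/-- The coordinates of a curve through prescribed points, at parameters `a`. -/
noncomputable def curve {F : Type*} [Field F] {κ : Type*} [Fintype κ] [DecidableEq κ] {m t : ℕ}
    (a : κ → F) (pts : κ → Fin m → F) (ω : Fin m → Fin t → F) (i : Fin m) : Polynomial F :=
  Lagrange.interpolate Finset.univ a (fun s => pts s i) +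
    Lagrange.nodal Finset.univ a * polyOfCoeffs (ω i)

theorem eval_curve_node {F κ : Type*} [Field F] [Fintype κ] [DecidableEq κ] {m t : ℕ}
    {a : κ → F} (ha : Function.Injective a) (pts : κ → Fin m → F) (ω : Fin m → Fin t → F)
    (i : Fin m) (s : κ) : (curve a pts ω i).eval (a s) = pts s i := by
  rw [curve, Polynomial.eval_add, Polynomial.eval_mul,
    Lagrange.eval_interpolate_at_node _ ha.injOn (Finset.mem_univ s),
    Lagrange.eval_nodal_at_node (Finset.mem_univ s), zero_mul, add_zero]

theorem natDegree_curve_le {F κ : Type*} [Field F] [Fintype κ] [DecidableEq κ] {m t k : ℕ}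
    {a : κ → F} (ha : Function.Injective a) (hk : Fintype.card κ ≤ k) (pts : κ → Fin m → F)
    (ω : Fin m → Fin t → F) (i : Fin m) : (curve a pts ω i).natDegree ≤ k + t := by
  refine (Polynomial.natDegree_add_le _ _).trans (max_le ?_ ?_)
  · refine (Polynomial.natDegree_le_of_degree_le
      (Lagrange.degree_interpolate_lt _ ha.injOn).le).trans ?_
    rw [Finset.card_univ]
    omega
  · refine Polynomial.natDegree_mul_le.trans (add_le_add ?_ (natDegree_polyOfCoeffs_le _))
    rw [Lagrange.natDegree_nodal, Finset.card_univ]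
    exact hk

theorem isWiseUniform_curve {F κ ι : Type*} [Field F] [Fintype F] [DecidableEq F] [Fintype κ]
    [DecidableEq κ] [DecidableEq ι] {m t : ℕ} (ht : 0 < t) {a : κ → F} {b : ι → F}
    (hb : Function.Injective b) (hab : ∀ s j, b j ≠ a s) (pts : κ → Fin m → F) :
    IsWiseUniform t fun (ω : Fin m → Fin t → F) j i => (curve a pts ω i).eval (b j) := by
  simp only [curve, Polynomial.eval_add, Polynomial.eval_mul]
  refine isWiseUniform_eval ht hb
    (fun j i => (Lagrange.interpolate Finset.univ a fun s => pts s i).eval (b j)) fun j => ?_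
  exact Lagrange.eval_nodal_not_at_node fun s _ => hab s j

theorem eval_aeval_polynomial {F σ : Type*} [Field F] (f : MvPolynomial σ F)
    (P : σ → Polynomial F) (x : F) :
    (MvPolynomial.aeval P f).eval x = MvPolynomial.eval (fun i => (P i).eval x) f := by
  induction f using MvPolynomial.induction_on with
  | C r => simp
  | add p q hp hq => simp [hp, hq]
  | mul_X p i hp => simp [hp]

theorem stmt_17 (q : ℕ) (F : Type) [Field F] [Fintype F] [DecidableEq F]
    (hF : Fintype.card F = q) (m : ℕ) (hm : 1 ≤ m)
    (σ δ : ℝ) (hσ : σ ∈ Set.Ioo (0 : ℝ) 1) (hδ : δ ∈ Set.Ioo (0 : ℝ) 1)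
    (hδσ : δ < (1 - σ) / 2)
    (t : ℕ) (hteven : Even t) (ht4 : 4 ≤ t)
    (k n d : ℕ) (hk : 0 < k) (hn : 0 < n) (hd : 1 < d)
    (hkn : k + n ≤ q) (hdσ : (d : ℝ) < σ * n / (k + t)) :
    LocallyCorrectable (ReedMullerCode F d m) k n δ
      (8 * ((4 * t * δ * n + 4 * (t : ℝ) ^ 2) /
        ((1 - σ - 2 * δ) ^ 2 * (n : ℝ) ^ 2)) ^ (t / 2)) := by
  intro S hS
  have hn0 : (0 : ℝ) < n := by exact_mod_cast hn
  obtain ⟨e⟩ := Function.Embedding.nonempty_of_card_le (α := S ⊕ Fin n) (β := F) (by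
    rw [Fintype.card_sum, Fintype.card_coe, Fintype.card_fin]
    omega)
  set a : S → F := fun s => e (.inl s) with ha_def
  set b : Fin n → F := fun j => e (.inr j) with hb_def
  have ha : Function.Injective a := e.injective.comp Sum.inl_injective
  have hb : Function.Injective b := e.injective.comp Sum.inr_injective
  have hab : ∀ s j, b j ≠ a s := fun s j h => Sum.inr_ne_inl (e.injective h)
  let P : (Fin m → Fin t → F) → Fin m → Polynomial F := curve a fun s => s.1
  let V : (Fin m → Fin t → F) → Fin n → Fin m → F := fun ω j i => (P ω i).eval (b j)
  have hV : IsWiseUniform t V := isWiseUniform_curve (by omega) hb hab _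
  set ρ : ℝ := (1 - σ) * n / 2 with hρ
  have hD : ((d * (k + t) : ℕ) : ℝ) + 2 * ρ ≤ Fintype.card (Fin n) := by
    rw [lt_div_iff₀ (by positivity)] at hdσ
    rw [Fintype.card_fin, hρ]
    push_cast
    linarith
  let T : (Fin m → Fin t → F) → Finset (Fin m → F) := fun ω => Finset.univ.image (V ω)
  have hT : ∀ ω j, V ω j ∈ T ω := fun ω j => Finset.mem_image_of_mem _ (Finset.mem_univ j)
  let G : (Fin m → Fin t → F) → (T : Finset (Fin m → F)) × ((↥T → F) → (↥S → F)) :=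
    fun ω => ⟨T ω, fun w s =>
      (nearbyPoly b (d * (k + t)) ρ fun j => w ⟨V ω j, hT ω j⟩).eval (a s)⟩
  refine ⟨(PMF.uniformOfFintype _).map G, ?_, ?_⟩
  · intro p hp
    obtain ⟨ω, -, rfl⟩ := (PMF.mem_support_map_iff _ _ _).1 hp
    exact Finset.card_image_le.trans (by simp)
  · rintro c ⟨f, hf, hfc⟩ y hyc
    refine ofReal_le_toOuterMeasure_map_uniformOfFintype G _
      (Finset.univ.filter fun ω =>
        ρ ≤ hammingDist (fun j => y (V ω j)) (fun j => c (V ω j))) ?_ ?_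
    · intro ω hω
      simp only [Finset.mem_filter, Finset.mem_univ, true_and, not_le] at hω
      have hcurve : ∀ x, (MvPolynomial.aeval (P ω) f).eval x =
          c fun i => (P ω i).eval x := fun x => by
        rw [eval_aeval_polynomial, hfc]
      have hdeg : (MvPolynomial.aeval (P ω) f).natDegree ≤ d * (k + t) :=
        MvPolynomial.aeval_natDegree_le f hf _
          fun i => natDegree_curve_le ha (by simpa using hS) _ ω i
      have hnear := nearbyPoly_eq hb hD (w := fun j => y (V ω j)) hdeg (by
        simp_rw [hcurve]
        exact hω)
      refine funext fun s => ?_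
      change (nearbyPoly b (d * (k + t)) ρ fun j => y (V ω j)).eval (a s) = c s.1
      rw [hnear, hcurve]
      congr 1
      exact funext fun i => eval_curve_node ha _ ω i s
    · have hA : 0 < (1 - σ - 2 * δ) * n / 2 := by
        have : 0 < 1 - σ - 2 * δ := by linarith
        positivity
      refine (hV.card_hammingDist_le hteven (by omega) hyc hA _ fun ω hω => ?_).trans_eq ?_
      · refine le_of_eq_of_le ?_ (Finset.mem_filter.1 hω).2
        rw [Fintype.card_fin, hρ]
        ring
      · rw [Fintype.card_fin]
        congr 3
        have : 1 - σ - 2 * δ ≠ 0 := by linarith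
        field_simp
        ring
end

section
/- Let q be a prime power and k, n, t, d, r positive integers with d ≥ 2, t ≥ 1, k + n ≤ q, and n ≥ r > d(k + t − 1). Let α_1,...,α_k, β_1,...,β_n be k + n pairwise distinct elements of F_q. Let C = {(f(β_1),...,f(β_n)) : f ∈ F_q[x], deg f ≤ k + t − 1} ⊆ F_q^n, and define ψ : C → F_q^k by ψ((f(β_1),...,f(β_n))) = (f(α_1),...,f(α_k)); this is well-defined since n > k + t − 1, so a polynomial of degree at most k + t − 1 is uniquely determined by its values at β_1,...,β_n. Then (C, ψ) is an (n, t, d, r; F_q^k/F_q)-codex. -/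
open scoped BigOperators

/-- The `d`-th power code `C^{*d}`: the linear span of all coordinatewise products
`c_1 * ⋯ * c_d` with `c_1, …, c_d ∈ C`. -/
def powerCode {F ι : Type*} [Field F] (C : Submodule F (ι → F)) (d : ℕ) :
    Submodule F (ι → F) :=
  Submodule.span F {x | ∃ c : Fin d → (ι → F), (∀ i, c i ∈ C) ∧ x = ∏ i, c i}

/-- `(C, ψ)` is an `(n, t, d, r; F^k/F)`-codex. -/
def IsCodex {F : Type*} [Field F] [DecidableEq F] (n t d r k : ℕ)
    (C : Submodule F (Fin n → F)) (ψ : C →ₗ[F] (Fin k → F)) : Prop :=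
  Function.Surjective ψ ∧
  (∃ h1 : (1 : Fin n → F) ∈ C, ψ ⟨1, h1⟩ = 1) ∧
  (∀ A : Finset (Fin n), A.card = t →
    Function.Surjective fun c : C =>
      ((ψ c, fun a : ↥A => (c : Fin n → F) a) : (Fin k → F) × (↥A → F))) ∧
  (∀ z ∈ powerCode C d, z ≠ 0 → n - r + 1 ≤ hammingNorm z) ∧
  (∃ ψbar : ↥(powerCode C d) →ₗ[F] (Fin k → F),
    (∀ (x : C) (hx : (x : Fin n → F) ∈ powerCode C d), ψbar ⟨x, hx⟩ = ψ x) ∧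
    (∀ (c : Fin d → C) (h : (∏ i, (c i : Fin n → F)) ∈ powerCode C d),
      ψbar ⟨∏ i, (c i : Fin n → F), h⟩ = ∏ i, ψ (c i)))

/-- The Reed-Solomon-type code `{(f(β_1), …, f(β_n)) : f ∈ F[x], deg f < s}`. -/
noncomputable def RSCode (F : Type*) [Field F] (n s : ℕ) (β : Fin n → F) :
    Submodule F (Fin n → F) :=
  Submodule.map (LinearMap.pi fun j => Polynomial.leval (β j)) (Polynomial.degreeLT F s)

open Polynomial in
theorem mem_RSCode_iff {F : Type*} [Field F] {n s : ℕ} {β : Fin n → F} {x : Fin n → F} :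
    x ∈ RSCode F n s β ↔ ∃ f ∈ degreeLT F s, (fun j => eval (β j) f) = x :=
  Iff.rfl

/-- The values at the points `α` of the polynomial interpolating a vector at the nodes `β`. -/
noncomputable def interpolatedValues {F : Type*} [Field F] {n k : ℕ} (α : Fin k → F)
    (β : Fin n → F) : (Fin n → F) →ₗ[F] (Fin k → F) :=
  (LinearMap.pi fun i => Polynomial.leval (α i)) ∘ₗ Lagrange.interpolate Finset.univ β

open Polynomial in
theorem interpolatedValues_eval {F : Type*} [Field F] {n k : ℕ} (α : Fin k → F)
    {β : Fin n → F} (hβ : Function.Injective β) {f : F[X]} (hf : f ∈ degreeLT F n) :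
    interpolatedValues α β (fun j => eval (β j) f) = fun i => eval (α i) f := by
  have h : f = Lagrange.interpolate Finset.univ β (fun j => eval (β j) f) :=
    Lagrange.eq_interpolate hβ.injOn (by simpa using mem_degreeLT.1 hf)
  funext i
  simp only [interpolatedValues, LinearMap.comp_apply, ← h]
  rfl

open Polynomial in
theorem prod_mem_degreeLT {F : Type*} [Field F] {d m : ℕ} {f : Fin d → F[X]}
    (hf : ∀ i, f i ∈ degreeLT F (m + 1)) : ∏ i, f i ∈ degreeLT F (d * m + 1) := by
  rw [mem_degreeLT]
  refine lt_of_le_of_lt (b := ((d * m : ℕ) : WithBot ℕ)) ?_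
    (by exact_mod_cast Nat.lt_succ_self _)
  refine natDegree_le_iff_degree_le.1 ((natDegree_prod_le _ _).trans ?_)
  refine (Finset.sum_le_card_nsmul _ _ m fun i _ => ?_).trans (by simp)
  by_cases h0 : f i = 0
  · simp [h0]
  · exact Nat.lt_succ_iff.1 ((natDegree_lt_iff_degree_lt h0).2 (mem_degreeLT.1 (hf i)))

theorem powerCode_RSCode_le {F : Type*} [Field F] {n : ℕ} (d m : ℕ) (β : Fin n → F) :
    powerCode (RSCode F n (m + 1) β) d ≤ RSCode F n (d * m + 1) β := by
  refine Submodule.span_le.2 ?_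
  rintro x ⟨c, hc, rfl⟩
  choose f hf hfc using fun i => mem_RSCode_iff.1 (hc i)
  refine mem_RSCode_iff.2 ⟨∏ i, f i, prod_mem_degreeLT hf, ?_⟩
  funext j
  simp [← hfc, Polynomial.eval_prod]

open Polynomial in
theorem le_hammingNorm_of_mem_RSCode {F : Type*} [Field F] [DecidableEq F] {n r : ℕ}
    {β : Fin n → F} (hβ : Function.Injective β) (hrn : r ≤ n) {z : Fin n → F}
    (hz : z ∈ RSCode F n r β) (hz0 : z ≠ 0) : n - r + 1 ≤ hammingNorm z := by
  obtain ⟨g, hg, rfl⟩ := mem_RSCode_iff.1 hz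
  have hg0 : g ≠ 0 := by
    rintro rfl
    exact hz0 (by funext j; simp)
  have hdeg : g.natDegree < r := (natDegree_lt_iff_degree_lt hg0).2 (mem_degreeLT.1 hg)
  have hroots : (Finset.univ.filter fun j => eval (β j) g = 0).card ≤ g.natDegree := by
    rw [← Finset.card_image_of_injective _ hβ]
    refine card_le_degree_of_subset_roots fun x hx => ?_
    obtain ⟨j, hj, rfl⟩ := Finset.mem_image.1 (Finset.mem_def.2 hx)
    exact (mem_roots hg0).2 (Finset.mem_filter.1 hj).2
  have hsum := Finset.card_filter_add_card_filter_not (s := (Finset.univ : Finset (Fin n)))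
    (fun j => eval (β j) g = 0)
  simp only [Finset.card_univ, Fintype.card_fin] at hsum
  have hnorm : hammingNorm (fun j => eval (β j) g)
      = (Finset.univ.filter fun j => ¬ eval (β j) g = 0).card := rfl
  omega

open Polynomial in
theorem exists_mem_degreeLT_eval_eq {F ι : Type*} [Field F] [Fintype ι] {v : ι → F}
    (hv : Function.Injective v) (y : ι → F) :
    ∃ f ∈ degreeLT F (Fintype.card ι), ∀ i, eval (v i) f = y i := by
  classical
  exact ⟨Lagrange.interpolate Finset.univ v y,
    mem_degreeLT.2 (Lagrange.degree_interpolate_lt y hv.injOn),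
    fun i => Lagrange.eval_interpolate_at_node y hv.injOn (Finset.mem_univ i)⟩

theorem stmt_19 (q k n t d r : ℕ) (F : Type) [Field F] [Fintype F] [DecidableEq F]
    (hF : Fintype.card F = q)
    (hk : 0 < k) (hn : 0 < n) (ht : 1 ≤ t) (hd : 2 ≤ d)
    (hknq : k + n ≤ q) (hrn : r ≤ n) (hdr : d * (k + t - 1) < r)
    (α : Fin k → F) (β : Fin n → F)
    (hdistinct : Function.Injective (Sum.elim α β)) :
    ∃ ψ : ↥(RSCode F n (k + t) β) →ₗ[F] (Fin k → F),
      (∀ (f : Polynomial F) (_ : f ∈ Polynomial.degreeLT F (k + t))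
         (hmem : (fun j => Polynomial.eval (β j) f) ∈ RSCode F n (k + t) β),
         ψ ⟨fun j => Polynomial.eval (β j) f, hmem⟩ = fun i => Polynomial.eval (α i) f) ∧
      IsCodex n t d r k (RSCode F n (k + t) β) ψ := by
  have hβ : Function.Injective β := hdistinct.comp Sum.inr_injective
  obtain ⟨m, hm⟩ : ∃ m, k + t = m + 1 := ⟨k + t - 1, by omega⟩
  have hdm : d * m + 1 ≤ r := by
    have : k + t - 1 = m := by omega
    rw [this] at hdr
    exact hdr
  have hmd : m ≤ d * m := Nat.le_mul_of_pos_left m (by omega)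
  have hle : k + t ≤ n := by omega
  have hval : ∀ f ∈ Polynomial.degreeLT F (k + t),
      interpolatedValues α β (fun j => Polynomial.eval (β j) f)
        = fun i => Polynomial.eval (α i) f :=
    fun f hf => interpolatedValues_eval α hβ (Polynomial.degreeLT_mono hle hf)
  have hsurj : ∀ A : Finset (Fin n), A.card = t → Function.Surjective
      fun c : RSCode F n (k + t) β =>
        ((interpolatedValues α β c, fun a : ↥A => (c : Fin n → F) a) :
          (Fin k → F) × (↥A → F)) := by
    rintro A hA ⟨y, w⟩
    have hv : Function.Injective (Sum.elim α fun a : ↥A => β a) := by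
      have := hdistinct.comp
        (Function.Injective.sumMap Function.injective_id (Subtype.val_injective (p := (· ∈ A))))
      rwa [Sum.elim_comp_map] at this
    obtain ⟨f, hf, hfy⟩ := exists_mem_degreeLT_eval_eq hv (Sum.elim y w)
    have hf' : f ∈ Polynomial.degreeLT F (k + t) := by simpa [hA] using hf
    refine ⟨⟨_, mem_RSCode_iff.2 ⟨f, hf', rfl⟩⟩, Prod.ext ?_ ?_⟩
    · exact (hval f hf').trans (funext fun i => hfy (Sum.inl i))
    · exact funext fun a => hfy (Sum.inr a)
  refine ⟨(interpolatedValues α β).domRestrict _, fun f hf _ => hval f hf, ?_, ?_, hsurj, ?_,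
    (interpolatedValues α β).domRestrict _, fun _ _ => rfl, ?_⟩
  · obtain ⟨A, -, hA⟩ := Finset.exists_subset_card_eq
      (s := (Finset.univ : Finset (Fin n))) (n := t) (by simp; omega)
    exact fun y => (hsurj A hA (y, 0)).imp fun c hc => congrArg Prod.fst hc
  · have h1 : (1 : Polynomial F) ∈ Polynomial.degreeLT F (k + t) := by
      rw [Polynomial.mem_degreeLT, Polynomial.degree_one]
      exact_mod_cast (by omega : 0 < k + t)
    refine ⟨mem_RSCode_iff.2 ⟨1, h1, by funext j; simp⟩, ?_⟩
    have := hval 1 h1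
    simp only [Polynomial.eval_one] at this
    exact this
  · intro z hz hz0
    rw [hm] at hz
    exact le_hammingNorm_of_mem_RSCode hβ hrn
      (Submodule.map_mono (Polynomial.degreeLT_mono hdm) (powerCode_RSCode_le d m β hz)) hz0
  · intro c _
    choose f hf hfc using fun i => mem_RSCode_iff.1 (c i).2
    have hprod : ∏ i, f i ∈ Polynomial.degreeLT F n :=
      Polynomial.degreeLT_mono (hdm.trans hrn) (prod_mem_degreeLT (hm ▸ hf))
    have hc : (∏ i, (c i : Fin n → F)) = fun j => Polynomial.eval (β j) (∏ i, f i) := by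
      funext j
      simp [← hfc, Polynomial.eval_prod]
    simp only [LinearMap.domRestrict_apply, hc, interpolatedValues_eval α hβ hprod]
    funext i
    simp only [← hfc, hval _ (hf _), Finset.prod_apply, Polynomial.eval_prod]
end
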